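/- Let ħ > 0, τ ∈ ℝ, d, n ∈ ℕ, and for each tuple μ = (μ₁, …, μₙ) ∈ (Fin d)ⁿ let a_μ ∈ 𝒮(ℝ^d; ℂ). Let h ∈ 𝒮(ℝ^d; ℂ). Then for every x ∈ ℝ^d, the iterated integral (2πħ)^{-d} ∫_{ℝ^d} [ Σ_{μ∈(Fin d)ⁿ} ( ∏_{j=1}^{n} p_{μ_j} ) ∫_{ℝ^d} a_μ(x + τ(y − x)) h(y) e^{i(x−y)·p/ħ} dy ] dp (inner integral in y absolutely convergent for each p, outer integral in p absolutely convergent) equals (−iħ)^n Σ_{μ∈(Fin d)ⁿ} Σ_{S ⊆ {1,…,n}} τ^{|S|} ( ∏_{j∈S} ∂_{x^{μ_j}} a_μ )(x) · ( ∏_{j∉S} ∂_{x^{μ_j}} h )(x). In particular the τ-quantization of a polynomial symbol Σ_μ a_μ(z) p_{μ₁}⋯p_{μₙ} is a differential operator of order n. (Flat-space case of the paper's Proposition on the quantization of polynomial symbols, Eq. (monomial_quant), where the factors ξ vanish except for the empty multiindex.) -/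

import Mathlib

open MeasureTheory Matrix Complex

/-- Partial derivative in the `ν`-th coordinate direction. -/
noncomputable def pderivCoord {d : ℕ} (ν : Fin d) (f : (Fin d → ℝ) → ℂ) :
    (Fin d → ℝ) → ℂ :=
  fun x => fderiv ℝ f x (Pi.single ν 1)

/-- Iterated partial derivative `∏_{j ∈ S} ∂_{x^{μ_j}}` (composed in increasing order of `j`). -/
noncomputable def pderivAlong {d n : ℕ} (μ : Fin n → Fin d) (S : Finset (Fin n))
    (f : (Fin d → ℝ) → ℂ) : (Fin d → ℝ) → ℂ :=
  (S.sort (· ≤ ·)).foldr (fun j g => pderivCoord (μ j) g) f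

open scoped FourierTransform ContDiff LineDeriv

/-- The oscillatory inner integral. -/
noncomputable def oscInt {d : ℕ} (hbar : ℝ) (x : Fin d → ℝ) (g : (Fin d → ℝ) → ℂ)
    (p : Fin d → ℝ) : ℂ :=
  ∫ y : Fin d → ℝ, g y *
    Complex.exp (Complex.I * (((x - y) ⬝ᵥ p : ℝ) : ℂ) / (hbar : ℂ))

/-- Transport of a Schwartz function to Euclidean space. -/
noncomputable def toE {d : ℕ} (g : SchwartzMap (Fin d → ℝ) ℂ) :
    SchwartzMap (EuclideanSpace ℝ (Fin d)) ℂ :=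
  SchwartzMap.compCLMOfContinuousLinearEquiv ℂ (EuclideanSpace.equiv (Fin d) ℝ) g

theorem toE_apply {d : ℕ} (g : SchwartzMap (Fin d → ℝ) ℂ) (v : EuclideanSpace ℝ (Fin d)) :
    toE g v = g (WithLp.ofLp v) := rfl

theorem osc_eq_fourier {d : ℕ} (hbar : ℝ) (hhbar : 0 < hbar) (x : Fin d → ℝ)
    (g : SchwartzMap (Fin d → ℝ) ℂ) (ξ : EuclideanSpace ℝ (Fin d)) :
    oscInt hbar x g ((2 * Real.pi * hbar) • WithLp.ofLp ξ) =
      Complex.exp ((↑(2 * Real.pi * inner ℝ ξ (WithLp.toLp 2 x)) * Complex.I)) •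
        (𝓕 (toE g) : SchwartzMap _ ℂ) ξ := by
  rw [SchwartzMap.fourier_coe, Real.fourier_eq', ← integral_smul, oscInt]
  rw [← (PiLp.volume_preserving_ofLp (Fin d)).integral_comp
    (MeasurableEquiv.toLp 2 (Fin d → ℝ)).symm.measurableEmbedding]
  congr 1
  ext v
  rw [smul_smul, ← Complex.exp_add, toE_apply, smul_eq_mul, mul_comm]
  congr 2
  have h1 : (inner ℝ ξ (WithLp.toLp 2 x) : ℝ) = x ⬝ᵥ WithLp.ofLp ξ := by
    simp [EuclideanSpace.inner_eq_star_dotProduct]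
  have h2 : (inner ℝ v ξ : ℝ) = WithLp.ofLp v ⬝ᵥ WithLp.ofLp ξ := by
    simp [EuclideanSpace.inner_eq_star_dotProduct, dotProduct_comm]
  rw [h1, h2, dotProduct_smul, sub_dotProduct]
  have : (hbar : ℂ) ≠ 0 := by exact_mod_cast hhbar.ne'
  push_cast [smul_eq_mul]
  field_simp
  ring

theorem osc_integrable {d : ℕ} (hbar : ℝ) (hhbar : 0 < hbar) (x : Fin d → ℝ)
    (g : SchwartzMap (Fin d → ℝ) ℂ) : Integrable (oscInt hbar x g) := by
  have hR : (2 * Real.pi * hbar) ≠ 0 := by positivity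
  rw [← integrable_comp_smul_iff volume (oscInt hbar x g) hR]
  rw [← (PiLp.volume_preserving_ofLp (Fin d)).integrable_comp_emb
    (MeasurableEquiv.toLp 2 (Fin d → ℝ)).symm.measurableEmbedding]
  have : ((fun p => oscInt hbar x g ((2 * Real.pi * hbar) • p)) ∘
      (WithLp.ofLp : EuclideanSpace ℝ (Fin d) → _)) = fun ξ =>
      Complex.exp ((↑(2 * Real.pi * inner ℝ ξ (WithLp.toLp 2 x)) * Complex.I)) •
        (𝓕 (toE g) : SchwartzMap _ ℂ) ξ := by
    ext ξ
    exact osc_eq_fourier hbar hhbar x g ξ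
  rw [this]
  have hi := (𝓕 (toE g) : SchwartzMap _ ℂ).integrable (μ := volume)
  refine hi.mono ?_ ?_
  · refine Continuous.aestronglyMeasurable ?_
    have := (𝓕 (toE g) : SchwartzMap _ ℂ).continuous
    fun_prop
  · refine Filter.Eventually.of_forall fun ξ => ?_
    rw [norm_smul, Complex.norm_exp_ofReal_mul_I, one_mul]

theorem osc_inversion {d : ℕ} (hbar : ℝ) (hhbar : 0 < hbar) (x : Fin d → ℝ)
    (g : SchwartzMap (Fin d → ℝ) ℂ) :
    ((2 * Real.pi * hbar) ^ d)⁻¹ • ∫ p, oscInt hbar x g p = g x := by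
  have h1 := Measure.integral_comp_smul volume (oscInt hbar x g) (2 * Real.pi * hbar)
  rw [Module.finrank_fin_fun, abs_of_pos (by positivity)] at h1
  rw [← h1]
  rw [← (PiLp.volume_preserving_ofLp (Fin d)).integral_comp
    (MeasurableEquiv.toLp 2 (Fin d → ℝ)).symm.measurableEmbedding]
  simp_rw [osc_eq_fourier hbar hhbar x g]
  rw [← Real.fourierInv_eq', ← SchwartzMap.fourierInv_coe, FourierTransform.fourierInv_fourier_eq]
  rfl

theorem osc_deriv {d : ℕ} (hbar : ℝ) (hhbar : 0 < hbar) (x : Fin d → ℝ)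
    (g : SchwartzMap (Fin d → ℝ) ℂ) (ν : Fin d) (p : Fin d → ℝ) :
    (p ν : ℂ) * oscInt hbar x g p = (-Complex.I * hbar) *
      oscInt hbar x (∂_{(Pi.single ν 1 : Fin d → ℝ)} g : SchwartzMap _ ℂ) p := by
  have hb : (hbar : ℂ) ≠ 0 := by exact_mod_cast hhbar.ne'
  set e : (Fin d → ℝ) → ℂ := fun y =>
    Complex.exp (Complex.I * (((x - y) ⬝ᵥ p : ℝ) : ℂ) / (hbar : ℂ)) with he
  let L : (Fin d → ℝ) →L[ℝ] ℝ := LinearMap.toContinuousLinearMap (dotProductBilin ℝ ℝ |>.flip p)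
  have hL : ∀ y, L y = y ⬝ᵥ p := fun y => rfl
  have hder : ∀ y, HasFDerivAt e ((e y) • ((Complex.I / (hbar : ℂ)) •
      (Complex.ofRealCLM.comp (-L)))) y := by
    intro y
    have h0 : HasFDerivAt (fun y => L (x - y)) (-L) y := by
      have := (L.hasFDerivAt (x := x - y)).comp y ((hasFDerivAt_id y).const_sub x)
      rw [ContinuousLinearMap.comp_neg] at this
      exact this
    have h1 := (Complex.ofRealCLM.hasFDerivAt.comp y h0).const_mul (Complex.I / (hbar : ℂ))
    have h2 := h1.cexp
    have h3 : e = fun y => Complex.exp (Complex.I / (hbar : ℂ) *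
        (Complex.ofRealCLM ∘ fun y => L (x - y)) y) := by
      ext y
      simp only [he, Function.comp, hL, Complex.ofRealCLM_apply]
      congr 1
      ring
    rw [h3]
    exact h2
  have hnorm : ∀ y, ‖e y‖ = 1 := by
    intro y
    have : e y = Complex.exp ((((x - y) ⬝ᵥ p / hbar : ℝ) : ℂ) * Complex.I) := by
      simp only [he]; congr 1; push_cast; ring
    rw [this, Complex.norm_exp_ofReal_mul_I]
  have hdiff : Differentiable ℝ e := fun y => (hder y).differentiableAt
  have hcont : Continuous e := hdiff.continuous
  have hgint : ∀ f : SchwartzMap (Fin d → ℝ) ℂ, Integrable (fun y => f y * e y) := by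
    intro f
    refine (f.integrable (μ := volume)).mono
      (f.continuous.mul hcont).aestronglyMeasurable (Filter.Eventually.of_forall fun y => ?_)
    rw [norm_mul, hnorm, mul_one]
  have hfe : ∀ y, fderiv ℝ e y (Pi.single ν 1) = -(Complex.I / hbar) * p ν * e y := by
    intro y
    rw [(hder y).fderiv]
    simp [hL]
    ring
  have key := integral_mul_fderiv_eq_neg_fderiv_mul_of_integrable (μ := volume) (f := g) (g := e)
    (v := Pi.single ν 1) (hgint (∂_{(Pi.single ν 1 : Fin d → ℝ)} g)) (by
      simp_rw [hfe]
      have := (hgint g).const_mul (-(Complex.I / hbar) * p ν)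
      refine this.congr (Filter.Eventually.of_forall fun y => ?_)
      simp only []
      ring) (hgint g) (fun y _ => g.differentiableAt) (fun y _ => hdiff y)
  simp_rw [hfe] at key
  have e1 : oscInt hbar x (∂_{(Pi.single ν 1 : Fin d → ℝ)} g : SchwartzMap _ ℂ) p =
      ∫ y, fderiv ℝ g y (Pi.single ν 1) * e y := rfl
  have e2 : (∫ y, g y * (-(Complex.I / hbar) * p ν * e y)) =
      (-(Complex.I / hbar) * p ν) * oscInt hbar x g p := by
    rw [oscInt, ← integral_const_mul]
    congr 1; ext y; simp only [he]; ring
  rw [e2] at key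
  rw [e1, ← neg_eq_iff_eq_neg.mpr key]
  field_simp
  linear_combination ((p ν : ℂ) * oscInt hbar x g p) * Complex.I_sq

/-- Iterated derivative along a list. -/
noncomputable def dlist {d n : ℕ} (μ : Fin n → Fin d) (L : List (Fin n))
    (f : (Fin d → ℝ) → ℂ) : (Fin d → ℝ) → ℂ :=
  L.foldr (fun j g => pderivCoord (μ j) g) f

theorem osc_list {d n : ℕ} (hbar : ℝ) (hhbar : 0 < hbar) (x : Fin d → ℝ) (μ : Fin n → Fin d)
    (g : SchwartzMap (Fin d → ℝ) ℂ) (L : List (Fin n)) :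
    ∃ g' : SchwartzMap (Fin d → ℝ) ℂ, ⇑g' = dlist μ L g ∧
      ∀ p : Fin d → ℝ, (L.map fun j => (p (μ j) : ℂ)).prod * oscInt hbar x g p =
        (-Complex.I * hbar) ^ L.length * oscInt hbar x g' p := by
  induction L with
  | nil => exact ⟨g, rfl, fun p => by simp⟩
  | cons j L ih =>
    obtain ⟨g', h1, h2⟩ := ih
    refine ⟨∂_{(Pi.single (μ j) 1 : Fin d → ℝ)} g', ?_, fun p => ?_⟩
    · ext y
      rw [SchwartzMap.lineDerivOp_apply_eq_fderiv, h1]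
      rfl
    · have := osc_deriv hbar hhbar x g' (μ j) p
      rw [List.map_cons, List.prod_cons, mul_assoc, h2, mul_left_comm, this, List.length_cons,
        pow_succ]
      ring

theorem pderivCoord_contDiff {d : ℕ} (ν : Fin d) {f : (Fin d → ℝ) → ℂ} (hf : ContDiff ℝ ∞ f) :
    ContDiff ℝ ∞ (pderivCoord ν f) :=
  (hf.fderiv_right (m := ∞) (by simp)).clm_apply contDiff_const

theorem dlist_contDiff {d n : ℕ} (μ : Fin n → Fin d) (L : List (Fin n))
    {f : (Fin d → ℝ) → ℂ} (hf : ContDiff ℝ ∞ f) : ContDiff ℝ ∞ (dlist μ L f) := by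
  induction L with
  | nil => exact hf
  | cons j L ih => exact pderivCoord_contDiff _ ih

theorem dlist_affine {d n : ℕ} (μ : Fin n → Fin d) (L : List (Fin n))
    {f : (Fin d → ℝ) → ℂ} (hf : ContDiff ℝ ∞ f) (x : Fin d → ℝ) (τ : ℝ) :
    dlist μ L (fun y => f (x + τ • (y - x))) =
      fun y => (τ : ℂ) ^ L.length * dlist μ L f (x + τ • (y - x)) := by
  induction L with
  | nil => simp [dlist]
  | cons j L ih =>
    change pderivCoord (μ j) (dlist μ L _) = _
    rw [ih]
    ext y
    have hd : Differentiable ℝ (dlist μ L f) :=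
      (dlist_contDiff μ L hf).differentiable (by simp)
    have h0 : HasFDerivAt (fun y : Fin d → ℝ => x + τ • (y - x))
        (τ • ContinuousLinearMap.id ℝ (Fin d → ℝ)) y :=
      (((hasFDerivAt_id y).sub_const x).const_smul τ).const_add x
    have h1 := ((hd (x + τ • (y - x))).hasFDerivAt.comp y h0).const_mul ((τ : ℂ) ^ L.length)
    have h2 := h1.fderiv
    change fderiv ℝ (fun y => (τ : ℂ) ^ L.length * dlist μ L f (x + τ • (y - x))) y _ = 
      _ * fderiv ℝ (dlist μ L f) (x + τ • (y - x)) _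
    simp only [Function.comp_def] at h2
    rw [h2]
    simp
    ring

theorem dlist_mul {d n : ℕ} (μ : Fin n → Fin d) (L : List (Fin n)) (hL : L.Nodup)
    {f g : (Fin d → ℝ) → ℂ} (hf : ContDiff ℝ ∞ f) (hg : ContDiff ℝ ∞ g) :
    dlist μ L (fun y => f y * g y) = fun y => ∑ S ∈ L.toFinset.powerset,
      dlist μ (L.filter (· ∈ S)) f y * dlist μ (L.filter (· ∉ S)) g y := by
  induction L with
  | nil => simp [dlist]
  | cons j L ih =>
    obtain ⟨hj, hL⟩ := List.nodup_cons.mp hL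
    change pderivCoord (μ j) (dlist μ L _) = _
    rw [ih hL]
    ext y
    have hd : ∀ (L : List (Fin n)) {f : (Fin d → ℝ) → ℂ}, ContDiff ℝ ∞ f → 
      HasFDerivAt (dlist μ L f) (fderiv ℝ (dlist μ L f) y) y := fun L f hf =>
      ((dlist_contDiff μ L hf).differentiable (by simp) y).hasFDerivAt
    have h1 := HasFDerivAt.fun_sum (u := L.toFinset.powerset) fun S _ =>
      (hd (L.filter (· ∈ S)) hf).mul (hd (L.filter (· ∉ S)) hg)
    rw [pderivCoord]
    have h2 := h1.fderiv
    simp only [Pi.mul_def] at h2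
    erw [h2]
    rw [List.toFinset_cons, Finset.sum_powerset_insert (by simpa using hj)]
    simp only [FunLike.coe_sum, Finset.sum_apply, ← Finset.sum_add_distrib]
    refine Finset.sum_congr rfl fun S hS => ?_
    have hjS : j ∉ S := fun h => hj (by simpa using Finset.mem_powerset.mp hS h)
    have a1 : (j :: L).filter (· ∈ S) = L.filter (· ∈ S) := by simp [hjS]
    have a2 : (j :: L).filter (· ∉ S) = j :: L.filter (· ∉ S) := by simp [hjS]
    have a3 : (j :: L).filter (· ∈ insert j S) = j :: L.filter (· ∈ S) := by
      simp only [List.filter_cons, Finset.mem_insert_self, decide_true, if_true]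
      congr 1
      refine List.filter_congr fun b hb => ?_
      have : b ≠ j := fun h => hj (h ▸ hb)
      simp [this]
    have a4 : (j :: L).filter (· ∉ insert j S) = L.filter (· ∉ S) := by
      rw [List.filter_cons]
      simp only [Finset.mem_insert_self, not_true_eq_false, decide_false, Bool.false_eq_true,
        if_false]
      refine List.filter_congr fun b hb => ?_
      have : b ≠ j := fun h => hj (h ▸ hb)
      simp [this]
    rw [a1, a2, a3, a4]
    change _ = _ * fderiv ℝ (dlist μ _ g) y _ + fderiv ℝ (dlist μ _ f) y _ * _
    simp
    ring

theorem sort_eq_filter {n : ℕ} (S : Finset (Fin n)) :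
    S.sort (· ≤ ·) = (List.finRange n).filter (· ∈ S) := by
  refine List.Perm.eq_of_pairwise' (r := (· ≤ ·)) (S.pairwise_sort _) ?_ ?_
  · refine List.Pairwise.filter _ ?_
    rw [← Fin.sort_univ]
    exact Finset.pairwise_sort _ _
  · rw [List.perm_ext_iff_of_nodup (S.sort_nodup _) ((List.nodup_finRange n).filter _)]
    simp

theorem pderivAlong_eq {d n : ℕ} (μ : Fin n → Fin d) (S : Finset (Fin n))
    (f : (Fin d → ℝ) → ℂ) :
    pderivAlong μ S f = dlist μ ((List.finRange n).filter (· ∈ S)) f := by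
  rw [pderivAlong, sort_eq_filter]; rfl

theorem exists_prod_schwartz {d : ℕ} (a h : SchwartzMap (Fin d → ℝ) ℂ) (x : Fin d → ℝ) (τ : ℝ) :
    ∃ g : SchwartzMap (Fin d → ℝ) ℂ, ⇑g = fun y => a (x + τ • (y - x)) * h y := by
  have h1 : Function.HasTemperateGrowth (fun y : Fin d → ℝ => x + τ • (y - x)) :=
    (Function.HasTemperateGrowth.const x).add
      ((Function.HasTemperateGrowth.const τ).smul
        (Function.HasTemperateGrowth.id'.sub (Function.HasTemperateGrowth.const x)))
  have h2 := a.hasTemperateGrowth.comp h1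
  exact ⟨SchwartzMap.smulLeftCLM ℂ _ h, SchwartzMap.smulLeftCLM_apply h2 h⟩

theorem term_eq {d n : ℕ} (hbar τ : ℝ) (hhbar : 0 < hbar) (x : Fin d → ℝ) (μ : Fin n → Fin d)
    (a h : SchwartzMap (Fin d → ℝ) ℂ) :
    ∃ g' : SchwartzMap (Fin d → ℝ) ℂ,
      (∀ p : Fin d → ℝ, (∏ j : Fin n, ((p (μ j) : ℝ) : ℂ)) *
          ∫ y : Fin d → ℝ, a (x + τ • (y - x)) * h y *
            Complex.exp (Complex.I * (((x - y) ⬝ᵥ p : ℝ) : ℂ) / (hbar : ℂ)) =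
        (-Complex.I * hbar) ^ n * oscInt hbar x g' p) ∧
      g' x = ∑ S : Finset (Fin n),
          (τ : ℂ) ^ S.card * pderivAlong μ S (⇑a) x * pderivAlong μ Sᶜ (⇑h) x := by
  obtain ⟨g, hg⟩ := exists_prod_schwartz a h x τ
  obtain ⟨g', h1, h2⟩ := osc_list hbar hhbar x μ g (List.finRange n)
  refine ⟨g', fun p => ?_, ?_⟩
  · have := h2 p
    rw [List.length_finRange] at this
    rw [← this, oscInt, hg, Fin.prod_univ_def]
  · have ha : ContDiff ℝ ∞ a := a.smooth ⊤
    have hh : ContDiff ℝ ∞ h := h.smooth ⊤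
    have hc : ContDiff ℝ ∞ (fun y : Fin d → ℝ => a (x + τ • (y - x))) := by
      apply ha.comp
      fun_prop
    rw [h1, hg, dlist_mul μ _ (List.nodup_finRange n) hc hh]
    simp only [List.toFinset_finRange, Finset.powerset_univ]
    refine Finset.sum_congr rfl fun S _ => ?_
    rw [dlist_affine μ _ ha, pderivAlong_eq, pderivAlong_eq, ← sort_eq_filter S,
      Finset.length_sort]
    simp

/-- Flat-space quantization of a polynomial symbol `Σ_μ a_μ(z) p_{μ₁}⋯p_{μₙ}`:
the `τ`-quantization applied to a Schwartz function `h` is the differential operator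
`(−iħ)^n Σ_μ Σ_{S⊆{1,…,n}} τ^{|S|} (∏_{j∈S} ∂_{μ_j} a_μ)(x) (∏_{j∉S} ∂_{μ_j} h)(x)`. -/
theorem polynomial_symbol_quantization
    (hbar τ : ℝ) (hhbar : 0 < hbar) (d n : ℕ)
    (a : (Fin n → Fin d) → SchwartzMap (Fin d → ℝ) ℂ)
    (h : SchwartzMap (Fin d → ℝ) ℂ) (x : Fin d → ℝ) :
    ((2 * Real.pi * hbar) ^ d)⁻¹ •
      (∫ p : Fin d → ℝ,
        ∑ μ : Fin n → Fin d, (∏ j : Fin n, ((p (μ j) : ℝ) : ℂ)) *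
          ∫ y : Fin d → ℝ, a μ (x + τ • (y - x)) * h y *
            Complex.exp (Complex.I * (((x - y) ⬝ᵥ p : ℝ) : ℂ) / (hbar : ℂ)))
      = (-Complex.I * hbar) ^ n *
        ∑ μ : Fin n → Fin d, ∑ S : Finset (Fin n),
          (τ : ℂ) ^ S.card * pderivAlong μ S (⇑(a μ)) x * pderivAlong μ Sᶜ (⇑h) x := by
  choose g' h1 h2 using fun μ : Fin n → Fin d => term_eq hbar τ hhbar x μ (a μ) h
  simp_rw [h1, ← h2]
  rw [integral_finsetSum _ fun μ _ => (osc_integrable hbar hhbar x (g' μ)).const_mul _]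
  simp_rw [integral_const_mul]
  rw [← Finset.mul_sum, ← mul_smul_comm, Finset.smul_sum]
  simp_rw [osc_inversion hbar hhbar x]
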